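/- There exists a randomized mechanism A : [-B,B]^n → ℝ (the one-dimensional Winsorized Mean Estimator) such that: (1) A is ε-differentially private with respect to the Hamming distance on datasets of n reals; (2) for every dataset X^n = (X_1,…,X_n) supported on [-B,B] that is (τ,γ)-concentrated, the output A(X^n) is β-close in total variation to the random variable (1/n)·∑_{i=1}^n X_i + ξ, where ξ is Laplace noise with scale 8τ/(nε) independent of X^n, and β = min{1, γ + (B/τ)·exp(−nε/8)}. -/

import Mathlib

open MeasureTheory Real

noncomputable section

/-- Two probability distributions are `β`-close if the total variation distance between them
is at most `β`, i.e. `|P(O) - Q(O)| ≤ β` for every measurable set `O`. -/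
def TVClose {Ω : Type*} [MeasurableSpace Ω] (P Q : Measure Ω) (β : ℝ) : Prop :=
  ∀ O : Set Ω, MeasurableSet O → |(P O).toReal - (Q O).toReal| ≤ β

/-- The Laplace distribution `Lap(b)` with scale `b`, given by density `(1/(2b)) e^{-|x|/b}`. -/
def laplaceMeasure (b : ℝ) : Measure ℝ :=
  volume.withDensity fun x => ENNReal.ofReal (Real.exp (-|x| / b) / (2 * b))

theorem LowerSemicontinuous.comp_of_continuous {X Y Z : Type*} [TopologicalSpace X]
    [TopologicalSpace Y] [Preorder Z] {f : Y → Z} {g : X → Y} (hf : LowerSemicontinuous f)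
    (hg : Continuous g) : LowerSemicontinuous fun x => f (g x) :=
  fun x z hz => (hg.tendsto x).eventually (hf (g x) z hz)

theorem LowerSemicontinuous.measurable_iInf_of_isCompact {X Y : Type*} [TopologicalSpace X]
    [MeasurableSpace X] [BorelSpace X] [TopologicalSpace Y] {K : Set Y} (hK : IsCompact K)
    (hne : K.Nonempty) {f : Y × X → ℝ} (hf : LowerSemicontinuous f)
    (hbdd : ∀ x, BddBelow (Set.range fun y : K => f (y, x))) :
    Measurable fun x => ⨅ y : K, f (y, x) := by
  refine measurable_of_Iic fun t => ?_
  have : CompactSpace K := isCompact_iff_compactSpace.mp hK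
  have : Nonempty K := hne.to_subtype
  have hg : LowerSemicontinuous fun p : K × X => f (p.1, p.2) :=
    hf.comp_of_continuous (by fun_prop)
  have hclosed : IsClosed (Prod.snd '' {p : K × X | f (p.1, p.2) ≤ t}) :=
    isClosedMap_snd_of_compactSpace _ (hg.isClosed_preimage t)
  convert hclosed.measurableSet using 1
  ext x
  simp only [Set.mem_preimage, Set.mem_Iic, Set.mem_image, Set.mem_ofPred_eq, Prod.exists,
    exists_eq_right]
  constructor
  · intro h
    have hx : LowerSemicontinuous fun y : K => f (y, x) := hf.comp_of_continuous (by fun_prop)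
    obtain ⟨y, -, hy⟩ := (hx.lowerSemicontinuousOn Set.univ).exists_isMinOn
      Set.univ_nonempty isCompact_univ
    exact ⟨y, (le_ciInf fun y' => hy (Set.mem_univ y')).trans h⟩
  · rintro ⟨y, hy⟩
    exact (ciInf_le (hbdd x) y).trans hy

theorem lowerSemicontinuous_hammingDist {ι X : Type*} [Fintype ι] [TopologicalSpace X] [T2Space X]
    [DecidableEq X] :
    LowerSemicontinuous fun p : (ι → X) × (ι → X) => (hammingDist p.1 p.2 : ℝ) := by
  have h : (fun p : (ι → X) × (ι → X) => (hammingDist p.1 p.2 : ℝ)) =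
      fun p => ∑ i, Set.indicator {p : (ι → X) × (ι → X) | p.1 i ≠ p.2 i} (fun _ => (1 : ℝ)) p := by
    ext p
    simp [hammingDist, Set.indicator_apply, Finset.card_filter, ite_not]
  rw [h]
  refine lowerSemicontinuous_sum fun i _ => IsOpen.lowerSemicontinuous_indicator ?_ zero_le_one
  exact isOpen_ne_fun (by fun_prop) (by fun_prop)

theorem integral_exp_neg_abs_div {b : ℝ} (hb : 0 < b) : ∫ z : ℝ, exp (-|z| / b) = 2 * b := by
  have h := integral_comp_abs (f := fun z => exp (-z / b))
  rw [h]
  have h2 := integral_exp_mul_Ioi (a := -b⁻¹) (by simpa using hb) 0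
  simp only [mul_zero, exp_zero] at h2
  have h3 : (fun z : ℝ => exp (-z / b)) = fun z => exp (-b⁻¹ * z) := by
    ext z; congr 1; ring
  rw [h3, h2]
  field_simp

theorem lintegral_exp_neg_abs_sub_div {b : ℝ} (hb : 0 < b) (m : ℝ) :
    ∫⁻ z : ℝ, ENNReal.ofReal (exp (-|z - m| / b)) = ENNReal.ofReal (2 * b) := by
  rw [lintegral_sub_right_eq_self (fun z => ENNReal.ofReal (exp (-|z| / b))) m,
    ← integral_exp_neg_abs_div hb, ofReal_integral_eq_lintegral_ofReal]
  · by_contra h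
    have := integral_exp_neg_abs_div hb
    rw [integral_undef h] at this
    linarith
  · exact Filter.Eventually.of_forall fun z => (exp_pos _).le

theorem laplaceMeasure_map_add_apply {b : ℝ} (hb : 0 < b) (m : ℝ) {O : Set ℝ}
    (hO : MeasurableSet O) :
    ((laplaceMeasure b).map fun ξ => m + ξ) O =
      (ENNReal.ofReal (2 * b))⁻¹ * ∫⁻ z in O, ENNReal.ofReal (exp (-|z - m| / b)) := by
  have hm : Measurable fun ξ : ℝ => m + ξ := by fun_prop
  rw [Measure.map_apply hm hO, laplaceMeasure, withDensity_apply _ (hm hO),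
    ← lintegral_const_mul _ (by fun_prop), ← lintegral_indicator (hm hO),
    ← lintegral_indicator hO]
  refine (lintegral_sub_right_eq_self _ m).symm.trans (lintegral_congr fun z => ?_)
  by_cases hz : z ∈ O
  · rw [Set.indicator_of_mem hz, Set.indicator_of_mem (by simpa using hz), div_eq_inv_mul,
      ENNReal.ofReal_mul (by positivity), ENNReal.ofReal_inv_of_pos (by positivity)]
  · rw [Set.indicator_of_notMem hz, Set.indicator_of_notMem (by simpa using hz)]

theorem isProbabilityMeasure_laplaceMeasure_map_add {b : ℝ} (hb : 0 < b) (m : ℝ) :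
    IsProbabilityMeasure ((laplaceMeasure b).map fun ξ => m + ξ) := by
  refine ⟨?_⟩
  rw [laplaceMeasure_map_add_apply hb m MeasurableSet.univ, setLIntegral_univ,
    lintegral_exp_neg_abs_sub_div hb]
  exact ENNReal.inv_mul_cancel (by simpa using hb) ENNReal.ofReal_ne_top

theorem TVClose.of_le_add {Ω : Type*} [MeasurableSpace Ω] {P Q : Measure Ω}
    [IsProbabilityMeasure P] [IsProbabilityMeasure Q] {β : ℝ} (hβ : 0 ≤ β)
    (h : ∀ O, MeasurableSet O → P O ≤ Q O + ENNReal.ofReal β) : TVClose P Q β := by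
  have key : ∀ O, MeasurableSet O → P.real O ≤ Q.real O + β := fun O hO => by
    have := ENNReal.toReal_mono (by finiteness) (h O hO)
    rwa [ENNReal.toReal_add (by finiteness) (by finiteness), ENNReal.toReal_ofReal hβ] at this
  intro O hO
  have h1 := key O hO
  have h2 := key Oᶜ hO.compl
  rw [probReal_compl_eq_one_sub hO, probReal_compl_eq_one_sub hO] at h2
  change |P.real O - Q.real O| ≤ β
  rw [abs_le]
  constructor <;> linarith

/-- Datasets in `[-B, B]^n` whose entries lie pairwise within `2τ` of each other. -/
def concentratedBox (n : ℕ) (B τ : ℝ) : Set (Fin n → ℝ) :=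
  {y | (∀ i, y i ∈ Set.Icc (-B) B) ∧ ∀ i j, |y i - y j| ≤ 2 * τ}

/-- The cost of explaining the output `z` on the dataset `x` by the dataset `y`: a penalty `κ`
for every entry where they differ, plus the negative log-density of Laplace noise with scale `b`
around the mean of `y`. -/
def surrogateCost {n : ℕ} (κ b : ℝ) (y x : Fin n → ℝ) (z : ℝ) : ℝ :=
  κ * hammingDist y x + |z - (∑ i, y i) / n| / b

/-- The least cost of explaining `z` on `x` by a concentrated dataset. -/
def surrogatePotential {n : ℕ} (B τ κ b : ℝ) (x : Fin n → ℝ) (z : ℝ) : ℝ :=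
  ⨅ y : concentratedBox n B τ, surrogateCost κ b y x z

section

variable {n : ℕ} {B τ κ b : ℝ}

theorem isClosed_concentratedBox : IsClosed (concentratedBox n B τ) := by
  have h : concentratedBox n B τ = Set.Icc (fun _ => -B) (fun _ => B) ∩
      ⋂ i, ⋂ j, {y | |y i - y j| ≤ 2 * τ} := by
    ext y
    simp [concentratedBox, Pi.le_def, forall_and]
  rw [h]
  exact isClosed_Icc.inter <| isClosed_iInter fun i => isClosed_iInter fun j =>
    isClosed_le (by fun_prop) (by fun_prop)

theorem isCompact_concentratedBox : IsCompact (concentratedBox n B τ) :=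
  (isCompact_Icc (a := fun _ : Fin n => -B) (b := fun _ => B)).of_isClosed_subset
    isClosed_concentratedBox fun _ hy => ⟨fun i => (hy.1 i).1, fun i => (hy.1 i).2⟩

theorem concentratedBox_nonempty (hB : 0 ≤ B) (hτ : 0 ≤ τ) : (concentratedBox n B τ).Nonempty :=
  ⟨0, fun i => by simpa using hB, fun i j => by simpa using hτ⟩

theorem surrogateCost_nonneg (hκ : 0 ≤ κ) (hb : 0 ≤ b) (y x : Fin n → ℝ) (z : ℝ) :
    0 ≤ surrogateCost κ b y x z := by
  unfold surrogateCost; positivity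

theorem bddBelow_surrogateCost (hκ : 0 ≤ κ) (hb : 0 ≤ b) (x : Fin n → ℝ) (z : ℝ) :
    BddBelow (Set.range fun y : concentratedBox n B τ => surrogateCost κ b y x z) :=
  ⟨0, by rintro _ ⟨y, rfl⟩; exact surrogateCost_nonneg hκ hb _ _ _⟩

theorem measurable_surrogatePotential (hB : 0 ≤ B) (hτ : 0 ≤ τ) (hκ : 0 ≤ κ) (hb : 0 ≤ b) :
    Measurable fun p : (Fin n → ℝ) × ℝ => surrogatePotential B τ κ b p.1 p.2 := by
  refine LowerSemicontinuous.measurable_iInf_of_isCompact (isCompact_concentratedBox)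
    (concentratedBox_nonempty hB hτ)
    (f := fun q : (Fin n → ℝ) × ((Fin n → ℝ) × ℝ) => surrogateCost κ b q.1 q.2.1 q.2.2)
    ?_ fun p => bddBelow_surrogateCost hκ hb p.1 p.2
  unfold surrogateCost
  refine LowerSemicontinuous.add ?_ (Continuous.lowerSemicontinuous (by fun_prop))
  have h1 : LowerSemicontinuous fun q : (Fin n → ℝ) × ((Fin n → ℝ) × ℝ) =>
      (hammingDist q.1 q.2.1 : ℝ) :=
    lowerSemicontinuous_hammingDist.comp_of_continuous
      (g := fun q : (Fin n → ℝ) × ((Fin n → ℝ) × ℝ) => (q.1, q.2.1)) (by fun_prop)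
  exact (continuous_const_mul κ).comp_lowerSemicontinuous h1
    (monotone_mul_left_of_nonneg hκ)

theorem surrogatePotential_le_add (hB : 0 ≤ B) (hτ : 0 ≤ τ) (hκ : 0 ≤ κ) (hb : 0 ≤ b)
    {x x' : Fin n → ℝ} (h : hammingDist x x' ≤ 1) (z : ℝ) :
    surrogatePotential B τ κ b x' z ≤ surrogatePotential B τ κ b x z + κ := by
  have : Nonempty (concentratedBox n B τ) := (concentratedBox_nonempty hB hτ).to_subtype
  rw [← sub_le_iff_le_add]
  refine le_ciInf fun y => ?_
  rw [sub_le_iff_le_add]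
  refine (ciInf_le (bddBelow_surrogateCost hκ hb x' z) y).trans ?_
  have h1 : (hammingDist y.1 x' : ℝ) ≤ hammingDist y.1 x + 1 := by
    exact_mod_cast (hammingDist_triangle y.1 x x').trans (by lia)
  have := mul_le_mul_of_nonneg_left h1 hκ
  simp only [surrogateCost]
  linarith

theorem abs_sum_div_le (hB : 0 ≤ B) {y : Fin n → ℝ} (hy : y ∈ concentratedBox n B τ) :
    |(∑ i, y i) / n| ≤ B := by
  rw [abs_div, Nat.abs_cast]
  refine div_le_of_le_mul₀ (by positivity) hB ?_
  refine (Finset.abs_sum_le_sum_abs _ _).trans ?_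
  refine (Finset.sum_le_card_nsmul _ _ B fun i _ => abs_le.mpr (hy.1 i)).trans ?_
  simp [mul_comm]

theorem abs_sub_abs_le_of_mem_concentratedBox (hB : 0 ≤ B) {y : Fin n → ℝ}
    (hy : y ∈ concentratedBox n B τ) (z : ℝ) : |z| - B ≤ |z - (∑ i, y i) / n| := by
  have := abs_sum_div_le hB hy
  have := abs_sub_abs_le_abs_sub z ((∑ i, y i) / n)
  linarith

theorem surrogatePotential_ge (hB : 0 ≤ B) (hτ : 0 ≤ τ) (hκ : 0 ≤ κ) (hb : 0 < b)
    (x : Fin n → ℝ) (z : ℝ) : (|z| - B) / b ≤ surrogatePotential B τ κ b x z := by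
  have : Nonempty (concentratedBox n B τ) := (concentratedBox_nonempty hB hτ).to_subtype
  refine le_ciInf fun y => ?_
  have h1 := div_le_div_of_nonneg_right (abs_sub_abs_le_of_mem_concentratedBox hB y.2 z) hb.le
  have : 0 ≤ κ * hammingDist y.1 x := by positivity
  simp only [surrogateCost]
  linarith

theorem surrogatePotential_le (hκ : 0 ≤ κ) (hb : 0 ≤ b) {x : Fin n → ℝ}
    (hx : x ∈ concentratedBox n B τ) (z : ℝ) :
    surrogatePotential B τ κ b x z ≤ |z - (∑ i, x i) / n| / b := by
  refine (ciInf_le (bddBelow_surrogateCost hκ hb x z) ⟨x, hx⟩).trans ?_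
  simp [surrogateCost]

theorem abs_sum_div_sub_le (hn : 0 < n) {x y : Fin n → ℝ} {D : ℝ} (h : ∀ i, |x i - y i| ≤ D) :
    |(∑ i, x i) / n - (∑ i, y i) / n| ≤ D * hammingDist y x / n := by
  rw [← sub_div, abs_div, Nat.abs_cast, ← Finset.sum_sub_distrib]
  refine div_le_div_of_nonneg_right ?_ (by positivity)
  refine (Finset.abs_sum_le_sum_abs _ _).trans ?_
  have h1 : ∀ i ∈ Finset.univ, |x i - y i| ≤ if y i ≠ x i then D else 0 := by
    intro i _
    split_ifs with hi
    · exact h i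
    · simp [not_not.mp hi]
  refine (Finset.sum_le_sum h1).trans ?_
  rw [← Finset.sum_filter, Finset.sum_const, nsmul_eq_mul, mul_comm]
  rfl

theorem le_surrogateCost (hn : 0 < n) (hb : 0 < b) (hκb : 4 * τ ≤ κ * n * b)
    {x y : Fin n → ℝ} (h : ∀ i, |x i - y i| ≤ 4 * τ) (z : ℝ) :
    |z - (∑ i, x i) / n| / b ≤ surrogateCost κ b y x z := by
  have hn' : (0 : ℝ) < n := by exact_mod_cast hn
  have h1 := abs_sum_div_sub_le hn h
  have h2 : 4 * τ * hammingDist y x / n ≤ κ * hammingDist y x * b := by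
    rw [div_le_iff₀ hn']
    have := mul_le_mul_of_nonneg_right hκb (Nat.cast_nonneg (α := ℝ) (hammingDist y x))
    linarith
  have h3 : |z - (∑ i, x i) / n| ≤
      |z - (∑ i, y i) / n| + |(∑ i, x i) / n - (∑ i, y i) / n| := by
    rw [abs_sub_comm ((∑ i, x i) / n)]
    exact abs_sub_le _ _ _
  rw [surrogateCost, div_le_iff₀ hb, add_mul, div_mul_cancel₀ _ hb.ne']
  linarith

theorem surrogatePotential_eq_of_le (hn : 0 < n) (hB : 0 ≤ B) (hτ : 0 ≤ τ) (hκ : 0 ≤ κ)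
    (hb : 0 < b) (hκb : 4 * τ ≤ κ * n * b) (hBτ : B ≤ 2 * τ) {x : Fin n → ℝ}
    (hx : x ∈ concentratedBox n B τ) (z : ℝ) :
    surrogatePotential B τ κ b x z = |z - (∑ i, x i) / n| / b := by
  have : Nonempty (concentratedBox n B τ) := (concentratedBox_nonempty hB hτ).to_subtype
  refine le_antisymm (surrogatePotential_le hκ hb.le hx z) (le_ciInf fun y => ?_)
  refine le_surrogateCost hn hb hκb (fun i => ?_) z
  have h1 := hx.1 i
  have h2 := y.2.1 i
  rw [abs_le]
  constructor <;> linarith [h1.1, h1.2, h2.1, h2.2]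

theorem min_le_surrogatePotential (hn : 0 < n) (hB : 0 ≤ B) (hτ : 0 ≤ τ)
    (hb : 0 < b) (hκb : 4 * τ ≤ κ * n * b) {x : Fin n → ℝ}
    (hx : x ∈ concentratedBox n B τ) (z : ℝ) :
    min (|z - (∑ i, x i) / n| / b) (κ * n + max 0 ((|z| - B) / b)) ≤
      surrogatePotential B τ κ b x z := by
  have : Nonempty (concentratedBox n B τ) := (concentratedBox_nonempty hB hτ).to_subtype
  refine le_ciInf fun y => ?_
  by_cases h : ∃ i, y.1 i = x i
  · obtain ⟨i, hi⟩ := h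
    refine (min_le_left _ _).trans (le_surrogateCost hn hb hκb (fun j => ?_) z)
    have h1 := hx.2 j i
    have h2 := y.2.2 i j
    rw [hi] at h2
    linarith [abs_sub_le (x j) (x i) (y.1 j)]
  · refine (min_le_right _ _).trans ?_
    push Not at h
    have h1 : hammingDist y.1 x = n := by simp [hammingDist, h]
    rw [surrogateCost, h1]
    have h2 := div_le_div_of_nonneg_right (abs_sub_abs_le_of_mem_concentratedBox hB y.2 z) hb.le
    have : 0 ≤ |z - (∑ i, y.1 i) / n| / b := by positivity
    have := max_le this h2
    linarith

end

/-- The unnormalized output density of the mechanism. -/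
def surrogateDensity {n : ℕ} (B τ κ b : ℝ) (x : Fin n → ℝ) (z : ℝ) : ENNReal :=
  ENNReal.ofReal (exp (-surrogatePotential B τ κ b x z))

/-- The mechanism whose output density is proportional to `exp (-surrogatePotential)`. -/
def surrogateMechanism {n : ℕ} (B τ κ b : ℝ) (x : Fin n → ℝ) : Measure ℝ :=
  (∫⁻ z, surrogateDensity B τ κ b x z)⁻¹ • volume.withDensity (surrogateDensity B τ κ b x)

section

variable {n : ℕ} {B τ κ b : ℝ}

theorem measurable_surrogateDensity (hB : 0 ≤ B) (hτ : 0 ≤ τ) (hκ : 0 ≤ κ) (hb : 0 ≤ b) :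
    Measurable fun p : (Fin n → ℝ) × ℝ => surrogateDensity B τ κ b p.1 p.2 :=
  (measurable_surrogatePotential hB hτ hκ hb).neg.exp.ennreal_ofReal

theorem surrogateMechanism_apply (x : Fin n → ℝ) {O : Set ℝ} (hO : MeasurableSet O) :
    surrogateMechanism B τ κ b x O =
      (∫⁻ z, surrogateDensity B τ κ b x z)⁻¹ * ∫⁻ z in O, surrogateDensity B τ κ b x z := by
  rw [surrogateMechanism, Measure.smul_apply, withDensity_apply _ hO, smul_eq_mul]

theorem lintegral_surrogateDensity_ne_zero (hB : 0 ≤ B) (hτ : 0 ≤ τ) (hκ : 0 ≤ κ) (hb : 0 ≤ b)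
    (x : Fin n → ℝ) : ∫⁻ z, surrogateDensity B τ κ b x z ≠ 0 := by
  intro h
  have hm : Measurable fun z => surrogateDensity B τ κ b x z :=
    Measurable.of_uncurry_left (f := surrogateDensity B τ κ b)
      (measurable_surrogateDensity hB hτ hκ hb)
  obtain ⟨z, hz⟩ := ((lintegral_eq_zero_iff hm).1 h).exists
  simp only [surrogateDensity, Pi.zero_apply, ENNReal.ofReal_eq_zero] at hz
  exact (exp_pos _).not_ge hz

theorem lintegral_surrogateDensity_ne_top (hB : 0 ≤ B) (hτ : 0 ≤ τ) (hκ : 0 ≤ κ) (hb : 0 < b)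
    (x : Fin n → ℝ) : ∫⁻ z, surrogateDensity B τ κ b x z ≠ ⊤ := by
  have h : ∀ z, surrogateDensity B τ κ b x z ≤
      ENNReal.ofReal (exp (B / b)) * ENNReal.ofReal (exp (-|z - 0| / b)) := fun z => by
    rw [← ENNReal.ofReal_mul (exp_pos _).le, ← exp_add]
    refine ENNReal.ofReal_le_ofReal (exp_le_exp.mpr ?_)
    have := surrogatePotential_ge hB hτ hκ hb x z
    rw [sub_zero, ← add_div]
    rw [sub_div] at this
    rw [add_div, neg_div]
    linarith
  refine ne_top_of_le_ne_top ?_ (lintegral_mono h)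
  rw [lintegral_const_mul _ (by fun_prop), lintegral_exp_neg_abs_sub_div hb]
  finiteness

theorem isProbabilityMeasure_surrogateMechanism (hB : 0 ≤ B) (hτ : 0 ≤ τ) (hκ : 0 ≤ κ)
    (hb : 0 < b) (x : Fin n → ℝ) : IsProbabilityMeasure (surrogateMechanism B τ κ b x) := by
  refine ⟨?_⟩
  rw [surrogateMechanism_apply x MeasurableSet.univ, setLIntegral_univ]
  exact ENNReal.inv_mul_cancel (lintegral_surrogateDensity_ne_zero hB hτ hκ hb.le x)
    (lintegral_surrogateDensity_ne_top hB hτ hκ hb x)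

theorem measurable_surrogateMechanism (hB : 0 ≤ B) (hτ : 0 ≤ τ) (hκ : 0 ≤ κ) (hb : 0 ≤ b) :
    Measurable (surrogateMechanism B τ κ b : (Fin n → ℝ) → Measure ℝ) := by
  refine Measure.measurable_of_measurable_coe _ fun O hO => ?_
  simp_rw [surrogateMechanism_apply _ hO]
  have h := measurable_surrogateDensity (n := n) hB hτ hκ hb
  have hint : ∀ μ : Measure ℝ, SFinite μ →
      Measurable fun x : Fin n → ℝ => ∫⁻ z, surrogateDensity B τ κ b x z ∂μ :=
    fun μ _ => Measurable.lintegral_prod_right'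
      (f := fun p : (Fin n → ℝ) × ℝ => surrogateDensity B τ κ b p.1 p.2) h
  exact (hint volume inferInstance).inv.mul (hint (volume.restrict O) inferInstance)

theorem surrogateDensity_le_mul (hB : 0 ≤ B) (hτ : 0 ≤ τ) (hκ : 0 ≤ κ) (hb : 0 ≤ b)
    {x x' : Fin n → ℝ} (h : hammingDist x x' ≤ 1) (z : ℝ) :
    surrogateDensity B τ κ b x z ≤ ENNReal.ofReal (exp κ) * surrogateDensity B τ κ b x' z := by
  rw [surrogateDensity, surrogateDensity, ← ENNReal.ofReal_mul (exp_pos _).le, ← exp_add]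
  refine ENNReal.ofReal_le_ofReal (exp_le_exp.mpr ?_)
  linarith [surrogatePotential_le_add hB hτ hκ hb h z]

theorem surrogateMechanism_le_mul (hB : 0 ≤ B) (hτ : 0 ≤ τ) (hκ : 0 ≤ κ) (hb : 0 ≤ b)
    {x x' : Fin n → ℝ} (h : hammingDist x x' ≤ 1) {O : Set ℝ} (hO : MeasurableSet O) :
    surrogateMechanism B τ κ b x O ≤
      ENNReal.ofReal (exp (2 * κ)) * surrogateMechanism B τ κ b x' O := by
  have hle : ∀ {x x' : Fin n → ℝ}, hammingDist x x' ≤ 1 → ∀ O : Set ℝ,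
      ∫⁻ z in O, surrogateDensity B τ κ b x z ≤
        ENNReal.ofReal (exp κ) * ∫⁻ z in O, surrogateDensity B τ κ b x' z := by
    intro x x' h O
    rw [← lintegral_const_mul' _ _ ENNReal.ofReal_ne_top]
    exact lintegral_mono fun z => surrogateDensity_le_mul hB hτ hκ hb h z
  have h0 : ENNReal.ofReal (exp κ) ≠ 0 := by simpa using exp_pos κ
  have hnorm : (∫⁻ z, surrogateDensity B τ κ b x z)⁻¹ ≤
      ENNReal.ofReal (exp κ) * (∫⁻ z, surrogateDensity B τ κ b x' z)⁻¹ := by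
    have := hle (by rwa [hammingDist_comm] : hammingDist x' x ≤ 1) Set.univ
    rw [setLIntegral_univ, setLIntegral_univ] at this
    rw [← ENNReal.inv_le_inv, ENNReal.mul_inv (.inl h0) (.inl ENNReal.ofReal_ne_top)] at this
    have := mul_le_mul_right this (ENNReal.ofReal (exp κ))
    rwa [← mul_assoc, ENNReal.mul_inv_cancel h0 ENNReal.ofReal_ne_top, one_mul] at this
  rw [surrogateMechanism_apply x hO, surrogateMechanism_apply x' hO]
  refine (mul_le_mul' hnorm (hle h O)).trans_eq ?_
  rw [two_mul, exp_add, ENNReal.ofReal_mul (exp_pos _).le]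
  ring

theorem lintegral_exp_neg_max_le (hB : 0 ≤ B) (hb : 0 < b) :
    ∫⁻ z : ℝ, ENNReal.ofReal (exp (-max 0 ((|z| - B) / b))) ≤ ENNReal.ofReal (2 * B + 4 * b) := by
  have h : ∀ z : ℝ, ENNReal.ofReal (exp (-max 0 ((|z| - B) / b))) ≤
      (Set.Icc (-B) B).indicator 1 z + (ENNReal.ofReal (exp (-|z - B| / b)) +
        ENNReal.ofReal (exp (-|z - -B| / b))) := fun z => by
    by_cases hz : z ∈ Set.Icc (-B) B
    · rw [Set.indicator_of_mem hz, Pi.one_apply]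
      refine le_add_right (ENNReal.ofReal_le_one.mpr (exp_le_one_iff.mpr ?_))
      simp
    · rw [Set.indicator_of_notMem hz, zero_add]
      have h0 : (|z| - B) / b ≤ max 0 ((|z| - B) / b) := le_max_right _ _
      rcases le_or_gt 0 z with hz0 | hz0
      · refine le_add_right (ENNReal.ofReal_le_ofReal (exp_le_exp.mpr ?_))
        have : B < z := by
          by_contra hh
          exact hz ⟨by linarith, by linarith⟩
        rw [abs_of_pos (by linarith : 0 < z - B), neg_div]
        rw [abs_of_nonneg hz0] at h0 ⊢
        linarith
      · refine le_add_left (ENNReal.ofReal_le_ofReal (exp_le_exp.mpr ?_))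
        have : z < -B := by
          by_contra hh
          exact hz ⟨by linarith, by linarith⟩
        rw [abs_of_neg (by linarith : z - -B < 0), neg_div]
        rw [abs_of_neg hz0] at h0 ⊢
        rw [show -(z - -B) = -z - B by ring]
        linarith
  refine (lintegral_mono h).trans_eq ?_
  rw [lintegral_add_left (measurable_one.indicator measurableSet_Icc),
    lintegral_add_left (by fun_prop), lintegral_indicator_one measurableSet_Icc,
    lintegral_exp_neg_abs_sub_div hb, lintegral_exp_neg_abs_sub_div hb, Real.volume_Icc,
    ← ENNReal.ofReal_add (by positivity) (by positivity),
    ← ENNReal.ofReal_add (by linarith) (by positivity)]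
  congr 1
  ring

theorem surrogateMechanism_le_laplaceMeasure_add (hn : 0 < n) (hB : 0 ≤ B) (hτ : 0 ≤ τ)
    (hκ : 0 ≤ κ) (hb : 0 < b) (hκb : 4 * τ ≤ κ * n * b) {β : ℝ}
    (hβ : B ≤ 2 * τ ∨ exp (-(κ * n)) * (B / b + 2) ≤ β) {x : Fin n → ℝ}
    (hx : x ∈ concentratedBox n B τ) {O : Set ℝ} (hO : MeasurableSet O) :
    surrogateMechanism B τ κ b x O ≤
      ((laplaceMeasure b).map fun ξ => (∑ i, x i) / n + ξ) O + ENNReal.ofReal β := by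
  rw [surrogateMechanism_apply x hO, laplaceMeasure_map_add_apply hb _ hO]
  rcases hβ with hBτ | hβ
  · have h : ∀ z, surrogateDensity B τ κ b x z =
        ENNReal.ofReal (exp (-|z - (∑ i, x i) / n| / b)) := fun z => by
      rw [surrogateDensity, surrogatePotential_eq_of_le hn hB hτ hκ hb hκb hBτ hx, neg_div]
    simp_rw [h, lintegral_exp_neg_abs_sub_div hb]
    exact le_self_add
  have hnorm : ENNReal.ofReal (2 * b) ≤ ∫⁻ z, surrogateDensity B τ κ b x z := by
    rw [← lintegral_exp_neg_abs_sub_div hb ((∑ i, x i) / n)]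
    refine lintegral_mono fun z => ENNReal.ofReal_le_ofReal (exp_le_exp.mpr ?_)
    rw [neg_div]
    exact neg_le_neg (surrogatePotential_le hκ hb.le hx z)
  have hdens : ∀ z, surrogateDensity B τ κ b x z ≤
      ENNReal.ofReal (exp (-|z - (∑ i, x i) / n| / b)) +
        ENNReal.ofReal (exp (-(κ * n))) *
          ENNReal.ofReal (exp (-max 0 ((|z| - B) / b))) := fun z => by
    rw [← ENNReal.ofReal_mul (exp_pos _).le, ← exp_add, surrogateDensity]
    rcases min_le_iff.mp (min_le_surrogatePotential hn hB hτ hb hκb hx z) with h | h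
    · refine le_add_right (ENNReal.ofReal_le_ofReal (exp_le_exp.mpr ?_))
      rw [neg_div]
      linarith
    · refine le_add_left (ENNReal.ofReal_le_ofReal (exp_le_exp.mpr ?_))
      linarith
  have hint : ∫⁻ z in O, surrogateDensity B τ κ b x z ≤
      (∫⁻ z in O, ENNReal.ofReal (exp (-|z - (∑ i, x i) / n| / b))) +
        ENNReal.ofReal (exp (-(κ * n))) * ENNReal.ofReal (2 * B + 4 * b) := by
    refine (lintegral_mono hdens).trans ?_
    rw [lintegral_add_left (by fun_prop), lintegral_const_mul _ (by fun_prop)]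
    gcongr
    exact (setLIntegral_le_lintegral _ _).trans (lintegral_exp_neg_max_le hB hb)
  refine (mul_le_mul' (ENNReal.inv_le_inv.mpr hnorm) hint).trans ?_
  rw [mul_add]
  gcongr
  rw [← ENNReal.ofReal_inv_of_pos (by positivity), ← ENNReal.ofReal_mul (exp_pos _).le,
    ← ENNReal.ofReal_mul (by positivity)]
  refine ENNReal.ofReal_le_ofReal (le_trans (le_of_eq ?_) hβ)
  field_simp
  ring

theorem measurable_laplaceMeasure_map_mean_add (hb : 0 < b) :
    Measurable fun x : Fin n → ℝ => (laplaceMeasure b).map fun ξ => (∑ i, x i) / n + ξ := by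
  refine Measure.measurable_of_measurable_coe _ fun O hO => ?_
  simp_rw [laplaceMeasure_map_add_apply hb _ hO]
  have h : Measurable fun p : (Fin n → ℝ) × ℝ =>
      ENNReal.ofReal (exp (-|p.2 - (∑ i, p.1 i) / n| / b)) := by fun_prop
  exact h.lintegral_prod_right'.const_mul _

end

theorem isProbabilityMeasure_bind_of_forall {X Y : Type*} [MeasurableSpace X] [MeasurableSpace Y]
    {P : Measure X} [IsProbabilityMeasure P] {f : X → Measure Y} (hf : Measurable f)
    (h : ∀ x, IsProbabilityMeasure (f x)) : IsProbabilityMeasure (P.bind f) := by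
  refine ⟨?_⟩
  rw [Measure.bind_apply MeasurableSet.univ hf.aemeasurable]
  simp

theorem TVClose.bind_of_le_add {X Y : Type*} [MeasurableSpace X] [MeasurableSpace Y]
    {P : Measure X} [IsProbabilityMeasure P] {f g : X → Measure Y} (hf : Measurable f)
    (hg : Measurable g) (hfp : ∀ x, IsProbabilityMeasure (f x))
    (hgp : ∀ x, IsProbabilityMeasure (g x)) {H : Set X} (hH : MeasurableSet H) {γ β : ℝ}
    (hγ : 0 ≤ γ) (hβ : 0 ≤ β) (hPH : P Hᶜ ≤ ENNReal.ofReal γ)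
    (h : ∀ x ∈ H, ∀ O, MeasurableSet O → f x O ≤ g x O + ENNReal.ofReal β) :
    TVClose (P.bind f) (P.bind g) (min 1 (γ + β)) := by
  have := isProbabilityMeasure_bind_of_forall (P := P) hf hfp
  have := isProbabilityMeasure_bind_of_forall (P := P) hg hgp
  refine TVClose.of_le_add (by positivity) fun O hO => ?_
  rcases min_choice 1 (γ + β) with hmin | hmin <;> rw [hmin]
  · exact prob_le_one.trans (by simp)
  rw [Measure.bind_apply hO hf.aemeasurable, Measure.bind_apply hO hg.aemeasurable]
  have hpt : ∀ x, f x O ≤ g x O + (ENNReal.ofReal β + Hᶜ.indicator 1 x) := fun x => by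
    by_cases hx : x ∈ H
    · simpa [hx] using h x hx O hO
    · refine (prob_le_one (μ := f x)).trans ?_
      simp [hx, ← add_assoc]
  refine (lintegral_mono hpt).trans ?_
  have hgO : Measurable fun x => g x O := (Measure.measurable_coe hO).comp hg
  rw [lintegral_add_left hgO, lintegral_add_left measurable_const,
    lintegral_indicator_one hH.compl, lintegral_const, measure_univ, mul_one, add_comm γ,
    ENNReal.ofReal_add hβ hγ]
  gcongr

/-- Theorem: one-dimensional Winsorized Mean Estimator.
There exists a randomized mechanism `A : [-B,B]^n → ℝ` such that:
(1) `A` is `ε`-differentially private with respect to the Hamming distance;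
(2) for every random dataset `X^n` supported on `[-B,B]` that is `(τ,γ)`-concentrated,
the output distribution of `A(X^n)` is `β`-close in total variation to the law of
`(1/n)·∑ X_i + ξ` with `ξ ∼ Lap(8τ/(nε))` independent of `X^n`, where
`β = min {1, γ + (B/τ)·exp(−nε/8)}`. -/
theorem winsorized_mean_one_dim
    (n : ℕ) (hn : 0 < n) (B ε τ γ : ℝ)
    (hB : 0 < B) (hε : 0 < ε) (hτ : 0 < τ) (hγ : 0 < γ) (hγ1 : γ < 1) :
    ∃ A : (Fin n → ℝ) → Measure ℝ,
      (∀ x, IsProbabilityMeasure (A x)) ∧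
      -- (1) ε-differential privacy w.r.t. the Hamming distance on `[-B,B]^n`
      (∀ x x' : Fin n → ℝ,
        (∀ i, x i ∈ Set.Icc (-B) B) → (∀ i, x' i ∈ Set.Icc (-B) B) →
        hammingDist x x' ≤ 1 →
        ∀ O : Set ℝ, MeasurableSet O →
          A x O ≤ ENNReal.ofReal (Real.exp ε) * A x' O) ∧
      -- (2) utility: for every (τ,γ)-concentrated dataset supported on [-B,B]
      (∀ (Ω : Type) (_ : MeasurableSpace Ω) (ℙ : Measure Ω),
        IsProbabilityMeasure ℙ →
        ∀ X : Ω → Fin n → ℝ, Measurable X →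
        (∀ ω i, X ω i ∈ Set.Icc (-B) B) →
        (∃ x₀ ∈ Set.Icc (-B) B,
          ENNReal.ofReal (1 - γ) ≤ ℙ {ω | ∀ i, |X ω i - x₀| ≤ τ}) →
        TVClose ((ℙ.map X).bind A)
          ((ℙ.map X).bind fun x =>
            (laplaceMeasure (8 * τ / (n * ε))).map fun ξ => (∑ i, x i) / n + ξ)
          (min 1 (γ + (B / τ) * Real.exp (-(n * ε) / 8)))) := by
  have hn' : (0 : ℝ) < n := by exact_mod_cast hn
  have hb : 0 < 8 * τ / (n * ε) := by positivity
  have hκ : 0 ≤ ε / 2 := by positivity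
  have hκb : 4 * τ ≤ ε / 2 * n * (8 * τ / (n * ε)) := by
    apply le_of_eq
    field_simp
    norm_num
  refine ⟨surrogateMechanism B τ (ε / 2) (8 * τ / (n * ε)), fun x =>
    isProbabilityMeasure_surrogateMechanism hB.le hτ.le hκ hb x, fun x x' _ _ h O hO => ?_, ?_⟩
  · simpa [mul_div_cancel₀] using surrogateMechanism_le_mul hB.le hτ.le hκ hb.le h hO
  intro Ω _ ℙ _ X hX hXB ⟨x₀, _, hconc⟩
  have := Measure.isProbabilityMeasure_map (μ := ℙ) hX.aemeasurable
  have hH : MeasurableSet (concentratedBox n B τ) := isClosed_concentratedBox.measurableSet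
  refine TVClose.bind_of_le_add (measurable_surrogateMechanism hB.le hτ.le hκ hb.le)
    (measurable_laplaceMeasure_map_mean_add hb)
    (fun x => isProbabilityMeasure_surrogateMechanism hB.le hτ.le hκ hb x)
    (fun x => isProbabilityMeasure_laplaceMeasure_map_add hb _) hH hγ.le (by positivity) ?_
    fun x hx O hO => surrogateMechanism_le_laplaceMeasure_add hn hB.le hτ.le hκ hb hκb ?_ hx hO
  · have hsub : ENNReal.ofReal (1 - γ) ≤ ℙ.map X (concentratedBox n B τ) := by
      rw [Measure.map_apply hX hH]
      refine hconc.trans (measure_mono fun ω hω => ⟨hXB ω, fun i j => ?_⟩)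
      have h1 : |X ω i - x₀| ≤ τ := hω i
      have h2 : |X ω j - x₀| ≤ τ := hω j
      rw [abs_sub_comm] at h2
      linarith [abs_sub_le (X ω i) x₀ (X ω j)]
    rw [prob_compl_eq_one_sub hH]
    refine (tsub_le_tsub_left hsub 1).trans_eq ?_
    rw [← ENNReal.ofReal_one, ← ENNReal.ofReal_sub _ (by linarith), sub_sub_cancel]
  · rw [or_iff_not_imp_left, not_le]
    intro hBτ
    have hR : 2 ≤ B / τ := by rw [le_div_iff₀ hτ]; exact hBτ.le
    have hu : 0 < n * ε / 8 := by positivity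
    have hBb : B / (8 * τ / (n * ε)) = B / τ * (n * ε / 8) := by field_simp
    have hexp : n * ε / 8 + 1 ≤ exp (3 * (n * ε / 8)) := by
      linarith [add_one_le_exp (3 * (n * ε / 8))]
    have hsplit : exp (-(n * ε) / 8) = exp (-(ε / 2 * n)) * exp (3 * (n * ε / 8)) := by
      rw [← exp_add]
      congr 1
      ring
    rw [hBb, hsplit, mul_left_comm]
    refine mul_le_mul_of_nonneg_left ?_ (exp_pos _).le
    refine le_trans ?_ (mul_le_mul_of_nonneg_left hexp (by positivity))
    linarith
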